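/- arXiv:1808.03343 — 2 statements merged into one kernel-verified Lean document; each statement's English description precedes it below -/
import Mathlib

section
/- Exact secrecy outage probability over Fox H-function wiretap fading channels (Theorem 2, eq. (13)): Let γ_B, γ_E be independent nonnegative random variables, where γ_B has a Fox H-function density with data (κ_B, λ_B, Θ_B, c_B) whose CCDF representation holds at some level σ' > 0, and γ_E has a Fox H-function density with data (κ_E, λ_E, Θ_E, c_E) with c_E < 1 and σ' + c_E > 1. Let R_t > 0, R_s = 2^{R_t}, W = R_s − 1. If all the iterated integrals below converge absolutely (so Fubini's theorem applies), then the secrecy outage probability satisfies Pr(C_s < R_t) = 1 − (κ_B κ_E W/(λ_B R_s)) · (1/(2π))² ∫_ℝ ∫_ℝ [Γ(ξ+s−1) Γ(1−s)/(ξ Γ(ξ))] Θ_B(1+ξ) Θ_E(s) (λ_B W)^{−ξ} (R_s/(λ_E W))^{s} dt' dt, where s = c_E + it, ξ = σ' + it', and C_s = max(log₂(1+γ_B) − log₂(1+γ_E), 0). -/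
open MeasureTheory Complex Set Filter
open scoped Real

noncomputable section

/-- Data of a Fox H-kernel: integers `0 ≤ m ≤ q`, `0 ≤ n ≤ p`, real parameters
`a, b` and positive reals `A, B`. -/
structure FoxData where
  p : ℕ
  q : ℕ
  m : ℕ
  n : ℕ
  hm : m ≤ q
  hn : n ≤ p
  a : Fin p → ℝ
  A : Fin p → ℝ
  b : Fin q → ℝ
  B : Fin q → ℝ
  hA : ∀ i, 0 < A i
  hB : ∀ l, 0 < B l

/-- The Fox H-kernel
`Θ(s) = [∏_{l<m} Γ(b_l + B_l s) ∏_{i<n} Γ(1 − a_i − A_i s)] /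
        [∏_{m≤l} Γ(1 − b_l − B_l s) ∏_{n≤i} Γ(a_i + A_i s)]`. -/
noncomputable def FoxData.kernel (D : FoxData) (s : ℂ) : ℂ :=
  ((∏ l : Fin D.q, if l.val < D.m then Complex.Gamma ((D.b l : ℂ) + (D.B l : ℂ) * s) else 1) *
    (∏ i : Fin D.p, if i.val < D.n then Complex.Gamma (1 - (D.a i : ℂ) - (D.A i : ℂ) * s) else 1)) /
  ((∏ l : Fin D.q, if D.m ≤ l.val then Complex.Gamma (1 - (D.b l : ℂ) - (D.B l : ℂ) * s) else 1) *
    (∏ i : Fin D.p, if D.n ≤ i.val then Complex.Gamma ((D.a i : ℂ) + (D.A i : ℂ) * s) else 1))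

/-- The vertical line `Re s = c` contains no pole of the kernel, i.e. none of the
numerator Gamma factors is evaluated at a nonpositive integer on that line. -/
def FoxData.noPoleOn (D : FoxData) (c : ℝ) : Prop :=
  ∀ t : ℝ,
    (∀ l : Fin D.q, l.val < D.m → ∀ k : ℕ,
      (D.b l : ℂ) + (D.B l : ℂ) * ((c : ℂ) + (t : ℂ) * Complex.I) ≠ -(k : ℂ)) ∧
    (∀ i : Fin D.p, i.val < D.n → ∀ k : ℕ,
      1 - (D.a i : ℂ) - (D.A i : ℂ) * ((c : ℂ) + (t : ℂ) * Complex.I) ≠ -(k : ℂ))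

/-- `f` is a Fox H-function density with data `(κ, λ, Θ, c)`:
`κ, λ > 0`, `t ↦ Θ(c+it)` is absolutely integrable, the line `Re s = c` contains no
pole of `Θ`, `f(x) = (κ/(2π)) ∫_ℝ Θ(c+it) (λx)^{−(c+it)} dt` for `x > 0`, and `f` is a
probability density on `(0,∞)`. -/
def IsFoxDensity (f : ℝ → ℝ) (κ lam : ℝ) (D : FoxData) (c : ℝ) : Prop :=
  0 < κ ∧ 0 < lam ∧ Measurable f ∧
  Integrable (fun t : ℝ => D.kernel ((c : ℂ) + (t : ℂ) * Complex.I)) ∧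
  D.noPoleOn c ∧
  (∀ x : ℝ, 0 < x →
    (f x : ℂ) = (κ : ℂ) / (2 * (π : ℝ)) *
      ∫ t : ℝ, D.kernel ((c : ℂ) + (t : ℂ) * Complex.I) *
        ((lam * x : ℝ) : ℂ) ^ (-((c : ℂ) + (t : ℂ) * Complex.I))) ∧
  (∀ x, 0 ≤ f x) ∧ (∫ x in Ioi (0 : ℝ), f x = 1)

/-- The CCDF representation holds for `f` (with data `(κ, λ, Θ, ·)`) at level `σ' > 0`:
`∫_x^∞ f(u) du = (κ/(2πλ)) ∫_ℝ [Θ(1+ξ)/ξ] (λx)^{−ξ} dt` for all `x > 0`, `ξ = σ' + it`. -/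
def HasCCDFRep (f : ℝ → ℝ) (κ lam : ℝ) (D : FoxData) (σ' : ℝ) : Prop :=
  0 < σ' ∧ ∀ x : ℝ, 0 < x →
    ((∫ u in Ioi x, f u : ℝ) : ℂ) = (κ : ℂ) / (2 * (π : ℝ) * lam) *
      ∫ t : ℝ, (D.kernel (1 + ((σ' : ℂ) + (t : ℂ) * Complex.I)) /
          ((σ' : ℂ) + (t : ℂ) * Complex.I)) *
        ((lam * x : ℝ) : ℂ) ^ (-((σ' : ℂ) + (t : ℂ) * Complex.I))

/-- The random variable `X` has probability density `f` (w.r.t. Lebesgue measure). -/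
def HasDensity {Ω : Type*} [MeasurableSpace Ω] (μ : Measure Ω) (X : Ω → ℝ) (f : ℝ → ℝ) : Prop :=
  Measurable X ∧ Measure.map X μ = volume.withDensity (fun x => ENNReal.ofReal (f x))

theorem ofReal_cpow_eq_exp_log {x : ℝ} (hx : 0 < x) (z : ℂ) :
    (x : ℂ) ^ z = cexp (Real.log x * z) := by
  rw [cpow_def_of_ne_zero (by exact_mod_cast hx.ne'), ofReal_log hx.le]

theorem image_div_one_sub_Ioo :
    (fun y : ℝ => y / (1 - y)) '' Ioo 0 1 = Ioi 0 := by
  ext x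
  simp only [mem_image, mem_Ioo, mem_Ioi]
  constructor
  · rintro ⟨y, ⟨h0, h1⟩, rfl⟩
    exact div_pos h0 (by linarith)
  · intro hx
    refine ⟨x / (1 + x), ⟨by positivity, by rw [div_lt_one (by positivity)]; linarith⟩, ?_⟩
    have : (1 + x) ≠ 0 := by positivity
    have h2 : 1 - x / (1 + x) = 1 / (1 + x) := by field_simp; ring
    rw [h2]; field_simp

/-- The Beta integral as a Mellin-type integral over the half-line. -/
theorem integral_Ioi_cpow_mul_one_add_cpow (u v : ℂ) :
    ∫ x in Ioi (0 : ℝ), (x : ℂ) ^ (u - 1) * ((1 + x : ℝ) : ℂ) ^ (-(u + v)) =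
      betaIntegral u v := by
  have hderiv : ∀ y ∈ Ioo (0 : ℝ) 1,
      HasDerivWithinAt (fun y : ℝ => y / (1 - y)) ((1 - y) ^ (-2 : ℤ)) (Ioo 0 1) y := by
    intro y hy
    have h1 : 1 - y ≠ 0 := by linarith [hy.2]
    have := ((hasDerivAt_id y).div ((hasDerivAt_id y).const_sub 1) h1).hasDerivWithinAt (s := Ioo 0 1)
    convert! this using 1
    simp only [id]
    rw [zpow_neg]
    field_simp
    norm_cast
    ring
  have hinj : InjOn (fun y : ℝ => y / (1 - y)) (Ioo 0 1) := by
    intro y hy z hz h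
    have h1 : 1 - y ≠ 0 := by linarith [hy.2]
    have h2 : 1 - z ≠ 0 := by linarith [hz.2]
    simp only at h
    rw [div_eq_div_iff h1 h2] at h
    linarith
  rw [← image_div_one_sub_Ioo,
    integral_image_eq_integral_abs_deriv_smul measurableSet_Ioo hderiv hinj, betaIntegral,
    intervalIntegral.integral_of_le zero_le_one, integral_Ioc_eq_integral_Ioo]
  refine setIntegral_congr_fun measurableSet_Ioo fun y hy => ?_
  have hy0 : 0 < y := hy.1
  have hw : 0 < 1 - y := by linarith [hy.2]
  have h1 : 1 + y / (1 - y) = (1 - y)⁻¹ := by field_simp; ring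
  have h2 : |(1 - y) ^ (-2 : ℤ)| = Real.exp (Real.log (1 - y) * (-2)) := by
    rw [abs_of_pos (by positivity), mul_comm, ← Real.log_rpow hw, Real.exp_log (by positivity)]
    norm_cast
  simp only [h1, h2, real_smul]
  rw [← ofReal_one, ← ofReal_sub, ofReal_cpow_eq_exp_log (div_pos hy0 hw),
    ofReal_cpow_eq_exp_log (inv_pos.2 hw), ofReal_cpow_eq_exp_log hy0, ofReal_cpow_eq_exp_log hw,
    Real.log_div hy0.ne' hw.ne', Real.log_inv, ofReal_exp, ← Complex.exp_add, ← Complex.exp_add,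
    ← Complex.exp_add]
  congr 1
  push_cast
  ring

theorem integral_Ioi_affine_cpow_mul_cpow {l k a w : ℝ} (hl : 0 < l) (hk : 0 < k) (ha : 0 < a)
    (hw : 0 < w) {z s : ℂ} (hs : s.re < 1) (hz : 1 < z.re + s.re) :
    ∫ x in Ioi (0 : ℝ), ((l * (a * x + w) : ℝ) : ℂ) ^ (-z) * ((k * x : ℝ) : ℂ) ^ (-s) =
      (w / a : ℝ) * (Gamma (z + s - 1) * Gamma (1 - s) / Gamma z) *
        ((l * w : ℝ) : ℂ) ^ (-z) * ((a / (k * w) : ℝ) : ℂ) ^ s := by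
  have haw : 0 < a / w := by positivity
  have key : ∀ x ∈ Ioi (0 : ℝ),
      ((l * (a * x + w) : ℝ) : ℂ) ^ (-z) * ((k * x : ℝ) : ℂ) ^ (-s) =
      (((l * w : ℝ) : ℂ) ^ (-z) * ((a / (k * w) : ℝ) : ℂ) ^ s) *
        (fun y : ℝ => (y : ℂ) ^ ((1 - s) - 1) *
          ((1 + y : ℝ) : ℂ) ^ (-((1 - s) + (z + s - 1)))) (a / w * x) := by
    intro x (hx : 0 < x)
    have h1 : l * (a * x + w) = (l * w) * (1 + a / w * x) := by field_simp; ring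
    have h2 : k * x = (k * w / a) * (a / w * x) := by field_simp
    have h3 : 1 - s - 1 = -s := by ring
    have h4 : 1 - s + (z + s - 1) = z := by ring
    have h5 : ((k * w / a : ℝ) : ℂ) ^ (-s) = ((a / (k * w) : ℝ) : ℂ) ^ s := by
      rw [ofReal_cpow_eq_exp_log (by positivity), ofReal_cpow_eq_exp_log (by positivity),
        ← inv_div a, Real.log_inv]
      push_cast
      ring_nf
    simp only [h1, h2, h3, h4]
    rw [ofReal_mul (l * w), mul_cpow_ofReal_nonneg (by positivity) (by positivity),
      ofReal_mul (k * w / a), mul_cpow_ofReal_nonneg (by positivity) (by positivity), h5]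
    ring
  rw [setIntegral_congr_fun measurableSet_Ioi key, integral_const_mul,
    integral_comp_mul_left_Ioi (fun y : ℝ => (y : ℂ) ^ ((1 - s) - 1) *
      ((1 + y : ℝ) : ℂ) ^ (-((1 - s) + (z + s - 1)))) 0 haw, mul_zero, integral_Ioi_cpow_mul_one_add_cpow,
    betaIntegral_eq_Gamma_mul_div _ _ (by simpa using hs) (by simp; linarith)]
  rw [show 1 - s + (z + s - 1) = z by ring, inv_div, real_smul]
  ring

theorem max_logb_sub_logb_lt_iff {x y R : ℝ} (hx : 0 ≤ x) (hy : 0 ≤ y) (hR : 0 < R) :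
    max (Real.logb 2 (1 + x) - Real.logb 2 (1 + y)) 0 < R ↔
      x < (2 : ℝ) ^ R * y + ((2 : ℝ) ^ R - 1) := by
  rw [max_lt_iff, and_iff_left hR, ← Real.logb_div (by positivity) (by positivity),
    Real.logb_lt_iff_lt_rpow one_lt_two (by positivity), div_lt_iff₀ (by positivity)]
  constructor <;> intro h <;> linarith

section Probability

variable {Ω : Type*} [MeasurableSpace Ω] {μ : Measure Ω}

theorem measureReal_affine_le_eq_integral [IsProbabilityMeasure μ] {X Y : Ω → ℝ}
    (hX : Measurable X) (hY : Measurable Y) (h : ProbabilityTheory.IndepFun X Y μ) (a w : ℝ) :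
    μ.real {ω | a * Y ω + w ≤ X ω} =
      ∫ y, (μ.map X).real (Ici (a * y + w)) ∂(μ.map Y) := by
  have : IsProbabilityMeasure (μ.map X) := Measure.isProbabilityMeasure_map hX.aemeasurable
  have : IsProbabilityMeasure (μ.map Y) := Measure.isProbabilityMeasure_map hY.aemeasurable
  have hS : MeasurableSet {p : ℝ × ℝ | a * p.1 + w ≤ p.2} :=
    measurableSet_le (by fun_prop) (by fun_prop)
  have hmap := h.symm.map_prod_eq_prod_map_map hY.aemeasurable hX.aemeasurable
  have hpre : {ω | a * Y ω + w ≤ X ω} =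
      (fun ω => (Y ω, X ω)) ⁻¹' {p : ℝ × ℝ | a * p.1 + w ≤ p.2} := rfl
  rw [measureReal_def, hpre, ← Measure.map_apply (hY.prodMk hX) hS, hmap,
    Measure.prod_apply hS, ← integral_toReal]
  · rfl
  · exact (measurable_measure_prodMk_left hS).aemeasurable
  · exact Eventually.of_forall fun y => measure_lt_top _ _

theorem HasDensity.integral_map_eq [IsProbabilityMeasure μ] {X : Ω → ℝ} {f : ℝ → ℝ}
    (hX : HasDensity μ X f) (hX0 : ∀ ω, 0 ≤ X ω) (hf : Measurable f) (hf0 : ∀ x, 0 ≤ f x)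
    (g : ℝ → ℝ) : ∫ x, g x ∂(μ.map X) = ∫ x in Ioi 0, f x * g x := by
  have hpos : ∀ᵐ x ∂(μ.map X), x ∈ Ioi (0 : ℝ) := by
    have h0 : ∀ᵐ x ∂(μ.map X), 0 ≤ x := by
      rw [ae_map_iff hX.1.aemeasurable measurableSet_Ici]
      exact Eventually.of_forall hX0
    have h1 : ∀ᵐ x ∂(μ.map X), x ≠ 0 := by
      rw [hX.2]
      exact (withDensity_absolutelyContinuous _ _).ae_le (Measure.ae_ne volume 0)
    filter_upwards [h0, h1] with x hx hx'
    exact lt_of_le_of_ne hx hx'.symm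
  rw [← Measure.restrict_eq_self_of_ae_mem hpos, hX.2, restrict_withDensity measurableSet_Ioi,
    integral_withDensity_eq_integral_toReal_smul (by fun_prop)
      (Eventually.of_forall fun x => ENNReal.ofReal_lt_top)]
  simp only [ENNReal.toReal_ofReal (hf0 _), smul_eq_mul]

theorem HasDensity.measureReal_Ici {X : Ω → ℝ} {f : ℝ → ℝ} (hX : HasDensity μ X f)
    (hf : Measurable f) (hf0 : ∀ x, 0 ≤ f x) (y : ℝ) :
    (μ.map X).real (Ici y) = ∫ x in Ioi y, f x := by
  rw [hX.2, measureReal_def, withDensity_apply _ measurableSet_Ici,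
    integral_eq_lintegral_of_nonneg_ae (Eventually.of_forall hf0) hf.aestronglyMeasurable,
    setLIntegral_congr Ioi_ae_eq_Ici]

theorem one_sub_outage_eq_integral [IsProbabilityMeasure μ] {X Y : Ω → ℝ} {f g : ℝ → ℝ}
    (hX0 : ∀ ω, 0 ≤ X ω) (hY0 : ∀ ω, 0 ≤ Y ω) (h : ProbabilityTheory.IndepFun X Y μ)
    (hX : HasDensity μ X f) (hf : Measurable f) (hf0 : ∀ x, 0 ≤ f x)
    (hY : HasDensity μ Y g) (hg : Measurable g) (hg0 : ∀ x, 0 ≤ g x) {R : ℝ} (hR : 0 < R) :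
    μ.real {ω | max (Real.logb 2 (1 + X ω) - Real.logb 2 (1 + Y ω)) 0 < R} =
      1 - ∫ y in Ioi 0, g y * ∫ x in Ioi ((2 : ℝ) ^ R * y + ((2 : ℝ) ^ R - 1)), f x := by
  have hset : {ω | max (Real.logb 2 (1 + X ω) - Real.logb 2 (1 + Y ω)) 0 < R} =
      {ω | (2 : ℝ) ^ R * Y ω + ((2 : ℝ) ^ R - 1) ≤ X ω}ᶜ := by
    ext ω
    simp only [mem_ofPred_eq, mem_compl_iff, not_le]
    exact max_logb_sub_logb_lt_iff (hX0 ω) (hY0 ω) hR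
  have hmeas : MeasurableSet {ω | (2 : ℝ) ^ R * Y ω + ((2 : ℝ) ^ R - 1) ≤ X ω} :=
    measurableSet_le ((hY.1.const_mul _).add_const _) hX.1
  rw [hset, probReal_compl_eq_one_sub hmeas, measureReal_affine_le_eq_integral hX.1 hY.1 h,
    hY.integral_map_eq hY0 hg hg0]
  simp only [hX.measureReal_Ici hf hf0]

end Probability

/-- Fubini exchange for an integrable kernel whose sections factor. -/
theorem integral_mul_integral_mul_swap {μ ν ρ : Measure ℝ} [SFinite μ] [SFinite ν] [SFinite ρ]
    {F G : ℝ → ℝ → ℂ}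
    (h : Integrable (fun p : ℝ × ℝ × ℝ => F p.1 p.2.1 * G p.1 p.2.2) (μ.prod (ν.prod ρ))) :
    ∫ x, (∫ t', F x t' ∂ν) * (∫ t, G x t ∂ρ) ∂μ =
      ∫ t, ∫ t', ∫ x, F x t' * G x t ∂μ ∂ν ∂ρ := by
  simp_rw [← integral_prod_mul]
  rw [integral_integral_swap (f := fun x (p : ℝ × ℝ) => F x p.1 * G x p.2) h,
    integral_prod_symm _ h.integral_prod_right]

/-- **Exact secrecy outage probability over Fox H-function wiretap fading channels
(Theorem 2, eq. (13)).**
For independent `γ_B, γ_E` with Fox H-function densities, the CCDF representation of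
`γ_B`'s density holding at level `σ'`, `c_E < 1 < σ' + c_E`, `R_s = 2^{R_t}`,
`W = R_s − 1`, and assuming Fubini's theorem applies,
`Pr(C_s < R_t) = 1 − (κ_B κ_E W/(λ_B R_s)) (1/(2π))² ∫∫ [Γ(ξ+s−1)Γ(1−s)/(ξΓ(ξ))]
Θ_B(1+ξ) Θ_E(s) (λ_B W)^{−ξ} (R_s/(λ_E W))^{s} dt' dt`, where `s = c_E + it`,
`ξ = σ' + it'`. -/
theorem sop_exact_foxH {Ω : Type*} [MeasurableSpace Ω] (μ : Measure Ω)
    [IsProbabilityMeasure μ] (γB γE : Ω → ℝ)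
    (hB0 : ∀ ω, 0 ≤ γB ω) (hE0 : ∀ ω, 0 ≤ γE ω)
    (hIndep : ProbabilityTheory.IndepFun γB γE μ)
    (fB fE : ℝ → ℝ) (κB lamB cB κE lamE cE σ' : ℝ) (DB DE : FoxData)
    (hfB : IsFoxDensity fB κB lamB DB cB) (hBf : HasDensity μ γB fB)
    (hCCDF : HasCCDFRep fB κB lamB DB σ')
    (hfE : IsFoxDensity fE κE lamE DE cE) (hEf : HasDensity μ γE fE)
    (hcE : cE < 1) (hσcE : 1 < σ' + cE)
    (Rt Rs W : ℝ) (hRt : 0 < Rt) (hRs : Rs = (2 : ℝ) ^ Rt) (hW : W = Rs - 1)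
    (hFub : IntegrableOn
      (fun p : ℝ × ℝ × ℝ =>
        (DB.kernel (1 + ((σ' : ℂ) + (p.2.1 : ℂ) * Complex.I)) /
            ((σ' : ℂ) + (p.2.1 : ℂ) * Complex.I)) *
          ((lamB * (Rs * p.1 + W) : ℝ) : ℂ) ^ (-((σ' : ℂ) + (p.2.1 : ℂ) * Complex.I)) *
          DE.kernel ((cE : ℂ) + (p.2.2 : ℂ) * Complex.I) *
          ((lamE * p.1 : ℝ) : ℂ) ^ (-((cE : ℂ) + (p.2.2 : ℂ) * Complex.I)))
      (Ioi (0 : ℝ) ×ˢ (univ : Set (ℝ × ℝ)))) :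
    ((μ {ω | max (Real.logb 2 (1 + γB ω) - Real.logb 2 (1 + γE ω)) 0 < Rt}).toReal : ℂ) =
      1 - ((κB * κE * W / (lamB * Rs) : ℝ) : ℂ) * ((1 / (2 * (π : ℝ)) : ℝ) : ℂ) ^ 2 *
        ∫ t : ℝ, ∫ t' : ℝ,
          Complex.Gamma (((σ' : ℂ) + (t' : ℂ) * Complex.I) +
              ((cE : ℂ) + (t : ℂ) * Complex.I) - 1) *
            Complex.Gamma (1 - ((cE : ℂ) + (t : ℂ) * Complex.I)) /
            (((σ' : ℂ) + (t' : ℂ) * Complex.I) *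
              Complex.Gamma ((σ' : ℂ) + (t' : ℂ) * Complex.I)) *
          DB.kernel (1 + ((σ' : ℂ) + (t' : ℂ) * Complex.I)) *
          DE.kernel ((cE : ℂ) + (t : ℂ) * Complex.I) *
          ((lamB * W : ℝ) : ℂ) ^ (-((σ' : ℂ) + (t' : ℂ) * Complex.I)) *
          ((Rs / (lamE * W) : ℝ) : ℂ) ^ ((cE : ℂ) + (t : ℂ) * Complex.I) := by
  obtain ⟨-, hlB, hfBm, -, -, -, hfB0, -⟩ := hfB
  obtain ⟨-, hlE, hfEm, -, -, hfE_eq, hfE0, -⟩ := hfE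
  obtain ⟨-, hccdf⟩ := hCCDF
  have hRs1 : 1 < Rs := hRs ▸ Real.one_lt_rpow one_lt_two hRt
  have hRs0 : 0 < Rs := by linarith
  have hW0 : 0 < W := by linarith
  set F : ℝ → ℝ → ℂ := fun x t' =>
    (DB.kernel (1 + ((σ' : ℂ) + (t' : ℂ) * Complex.I)) / ((σ' : ℂ) + (t' : ℂ) * Complex.I)) *
      ((lamB * (Rs * x + W) : ℝ) : ℂ) ^ (-((σ' : ℂ) + (t' : ℂ) * Complex.I)) with hF
  set G : ℝ → ℝ → ℂ := fun x t =>
    DE.kernel ((cE : ℂ) + (t : ℂ) * Complex.I) *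
      ((lamE * x : ℝ) : ℂ) ^ (-((cE : ℂ) + (t : ℂ) * Complex.I)) with hG
  have hint : Integrable (fun p : ℝ × ℝ × ℝ => F p.1 p.2.1 * G p.1 p.2.2)
      ((volume.restrict (Ioi 0)).prod (volume.prod volume)) := by
    rw [IntegrableOn, Measure.volume_eq_prod, ← Measure.prod_restrict, Measure.restrict_univ,
      Measure.volume_eq_prod] at hFub
    simpa only [hF, hG, mul_assoc] using hFub
  have hprob := one_sub_outage_eq_integral hB0 hE0 hIndep hBf hfBm hfB0 hEf hfEm hfE0 hRt
  rw [← hRs, ← hW] at hprob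
  rw [← measureReal_def, hprob, ofReal_sub, ofReal_one, ← integral_complex_ofReal]
  have hpt : ∀ x ∈ Ioi (0 : ℝ), ((fE x * ∫ u in Ioi (Rs * x + W), fB u : ℝ) : ℂ) =
      ((κB : ℂ) / (2 * (π : ℝ) * lamB) * ((κE : ℂ) / (2 * (π : ℝ)))) *
        ((∫ t', F x t') * ∫ t, G x t) := by
    intro x (hx : 0 < x)
    rw [ofReal_mul, hfE_eq x hx, hccdf (Rs * x + W) (by positivity)]
    ring
  rw [setIntegral_congr_fun measurableSet_Ioi hpt, integral_const_mul,
    integral_mul_integral_mul_swap hint]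
  congr 1
  have hinner : ∀ t t' : ℝ, ∫ x in Ioi (0 : ℝ), F x t' * G x t =
      ((W / Rs : ℝ) : ℂ) *
        (Complex.Gamma (((σ' : ℂ) + (t' : ℂ) * Complex.I) +
              ((cE : ℂ) + (t : ℂ) * Complex.I) - 1) *
            Complex.Gamma (1 - ((cE : ℂ) + (t : ℂ) * Complex.I)) /
            (((σ' : ℂ) + (t' : ℂ) * Complex.I) *
              Complex.Gamma ((σ' : ℂ) + (t' : ℂ) * Complex.I)) *
          DB.kernel (1 + ((σ' : ℂ) + (t' : ℂ) * Complex.I)) *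
          DE.kernel ((cE : ℂ) + (t : ℂ) * Complex.I) *
          ((lamB * W : ℝ) : ℂ) ^ (-((σ' : ℂ) + (t' : ℂ) * Complex.I)) *
          ((Rs / (lamE * W) : ℝ) : ℂ) ^ ((cE : ℂ) + (t : ℂ) * Complex.I)) := by
    intro t t'
    have hmellin := integral_Ioi_affine_cpow_mul_cpow hlB hlE hRs0 hW0
      (z := (σ' : ℂ) + (t' : ℂ) * Complex.I) (s := (cE : ℂ) + (t : ℂ) * Complex.I)
      (by simpa using hcE) (by simpa using hσcE)
    calc ∫ x in Ioi (0 : ℝ), F x t' * G x t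
        = ∫ x in Ioi (0 : ℝ),
          (DB.kernel (1 + ((σ' : ℂ) + (t' : ℂ) * Complex.I)) /
            ((σ' : ℂ) + (t' : ℂ) * Complex.I) * DE.kernel ((cE : ℂ) + (t : ℂ) * Complex.I)) *
          (((lamB * (Rs * x + W) : ℝ) : ℂ) ^ (-((σ' : ℂ) + (t' : ℂ) * Complex.I)) *
            ((lamE * x : ℝ) : ℂ) ^ (-((cE : ℂ) + (t : ℂ) * Complex.I))) := by
          refine integral_congr_ae (Eventually.of_forall fun x => ?_)
          simp only [hF, hG]
          ring
      _ = _ := by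
          rw [integral_const_mul, hmellin]
          generalize (σ' : ℂ) + (t' : ℂ) * Complex.I = ξ
          ring
  simp_rw [hinner, integral_const_mul]
  rw [← mul_assoc]
  congr 1
  push_cast
  ring
end
end

section
/- Wiretap-channel capacity term of the average secrecy capacity (Theorem 4, eq. (22)): Let γ_E be a nonnegative random variable with Fox H-function density f_E with data (κ_E, λ_E, Θ_E, c_E), let c ∈ (−1, 0), and assume ∫₀^∞ x^{s−1} f_E(x) dx converges absolutely and equals κ_E λ_E^{−s} Θ_E(s) for all s with Re s = 1 − c. Assume E[ln(1+γ_E)] < ∞ and that t ↦ Θ_E(1−c−it) π/((c+it) sin(π(c+it))) is absolutely integrable and the Mellin inversion formula for f_E holds on the line Re s = 1−c. Then ∫₀^∞ ln(1+γ) f_E(γ) dγ = κ_E · (1/(2π)) ∫_ℝ Θ_E(1−s) λ_E^{s−1} [π/(s sin(πs))] dt, where s = c + it. -/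
open MeasureTheory Complex Set Filter
open scoped Real

noncomputable section

open scoped Topology

/-- `log (1 + x)` is dominated by every power `x ^ ε / ε` with `0 < ε ≤ 1`. -/
theorem log_one_add_le_rpow_div {x ε : ℝ} (hx : 0 < x) (hε : 0 < ε) (hε1 : ε ≤ 1) :
    Real.log (1 + x) ≤ x ^ ε / ε := by
  rw [le_div_iff₀ hε, mul_comm, ← Real.log_rpow (by linarith)]
  calc Real.log ((1 + x) ^ ε) ≤ Real.log (1 + x ^ ε) := by
        apply Real.log_le_log (by positivity)
        simpa using Real.rpow_add_le_add_rpow zero_le_one hx.le hε.le hε1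
    _ ≤ x ^ ε := by
        have := Real.log_le_sub_one_of_pos (x := 1 + x ^ ε) (by positivity)
        linarith

/-- The map `x ↦ (1 + x)⁻¹` has a convergent Mellin transform on the strip `0 < Re s < 1`. -/
theorem mellinConvergent_inv_one_add {s : ℂ} (h0 : 0 < s.re) (h1 : s.re < 1) :
    MellinConvergent (fun x : ℝ => (1 + (x : ℂ))⁻¹) s := by
  have hnorm : ∀ x : ℝ, 0 < x → ‖(1 + (x : ℂ))⁻¹‖ = (1 + x)⁻¹ := fun x hx => by
    rw [norm_inv, ← ofReal_one, ← ofReal_add, norm_real, Real.norm_of_nonneg (by positivity)]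
  refine mellinConvergent_of_isBigO_rpow (a := 1) (b := 0) ?_ ?_ h1 ?_ h0
  · refine ContinuousOn.locallyIntegrableOn ?_ measurableSet_Ioi
    refine ContinuousOn.inv₀ (by fun_prop) fun x (hx : 0 < x) h => ?_
    have := congrArg re h
    simp at this
    linarith
  · refine Asymptotics.IsBigO.of_bound 1 ?_
    filter_upwards [eventually_gt_atTop 0] with x hx
    rw [hnorm x hx, Real.norm_of_nonneg (by positivity), Real.rpow_neg_one, one_mul]
    gcongr
    linarith
  · refine Asymptotics.IsBigO.of_bound 1 ?_
    filter_upwards [self_mem_nhdsWithin] with x (hx : 0 < x)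
    rw [hnorm x hx]
    simpa using inv_le_one_of_one_le₀ (by linarith : 1 ≤ 1 + x)

/-- The Laplace transform of the constant `1`, evaluated at `1 + x`. -/
theorem integral_exp_neg_mul_one_add {x : ℝ} (hx : 0 < x) :
    ∫ w in Ioi (0 : ℝ), Real.exp (-(w * (1 + x))) = (1 + x)⁻¹ := by
  have h := integral_exp_mul_Ioi (a := -(1 + x)) (by linarith) 0
  simp only [mul_zero, Real.exp_zero, neg_div_neg_eq, one_div] at h
  rw [← h]
  congr 1; ext w; congr 1; ring

/-- Integrability of the kernel whose two iterated integrals are the Mellin transform of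
`(1 + x)⁻¹` and `Γ(s) Γ(1 - s)`. -/
theorem integrable_cpow_mul_exp_prod {s : ℂ} (h0 : 0 < s.re) (h1 : s.re < 1) :
    Integrable (fun p : ℝ × ℝ => (p.1 : ℂ) ^ (s - 1) * (Real.exp (-(p.2 * (1 + p.1))) : ℂ))
      ((volume.restrict (Ioi 0)).prod (volume.restrict (Ioi 0))) := by
  rw [integrable_prod_iff]
  · constructor
    · filter_upwards [ae_restrict_mem measurableSet_Ioi] with x (hx : 0 < x)
      refine Integrable.const_mul ?_ _
      refine Integrable.ofReal ?_
      have := integrableOn_exp_mul_Ioi (a := -(1 + x)) (by linarith) 0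
      refine this.congr_fun (fun w _ => ?_) measurableSet_Ioi
      simp only; congr 1; ring
    · refine (mellinConvergent_inv_one_add h0 h1).norm.congr ?_
      filter_upwards [ae_restrict_mem measurableSet_Ioi] with x (hx : 0 < x)
      simp only [norm_mul, norm_real, Real.norm_eq_abs, Real.abs_exp, smul_eq_mul]
      rw [integral_const_mul, integral_exp_neg_mul_one_add hx, norm_inv, ← ofReal_one, ← ofReal_add, norm_real,
        Real.norm_of_nonneg (by positivity)]
  · exact Measurable.aestronglyMeasurable (by fun_prop)

/-- The Mellin transform of `(1 + x)⁻¹` is `π / sin (π s)` on the strip `0 < Re s < 1`. -/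
theorem mellin_inv_one_add {s : ℂ} (h0 : 0 < s.re) (h1 : s.re < 1) :
    mellin (fun x : ℝ => (1 + (x : ℂ))⁻¹) s = π / sin (π * s) := by
  have hswap := integral_integral_swap (f := fun x w : ℝ =>
    (x : ℂ) ^ (s - 1) * (Real.exp (-(w * (1 + x))) : ℂ)) (integrable_cpow_mul_exp_prod h0 h1)
  have hleft : mellin (fun x : ℝ => (1 + (x : ℂ))⁻¹) s =
      ∫ x in Ioi (0 : ℝ), ∫ w in Ioi (0 : ℝ),
        (x : ℂ) ^ (s - 1) * (Real.exp (-(w * (1 + x))) : ℂ) := by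
    refine setIntegral_congr_fun measurableSet_Ioi fun x (hx : 0 < x) => ?_
    simp only [smul_eq_mul]
    rw [integral_const_mul, integral_complex_ofReal, integral_exp_neg_mul_one_add hx]
    push_cast
    rfl
  have hright : ∫ w in Ioi (0 : ℝ), ∫ x in Ioi (0 : ℝ),
        (x : ℂ) ^ (s - 1) * (Real.exp (-(w * (1 + x))) : ℂ) =
      ∫ w in Ioi (0 : ℝ), Gamma s * ((w : ℂ) ^ ((1 - s) - 1) * exp (-((1 : ℝ) * w))) := by
    refine setIntegral_congr_fun measurableSet_Ioi fun w (hw : 0 < w) => ?_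
    have hG := integral_cpow_mul_exp_neg_mul_Ioi h0 hw
    have hw0 : (w : ℂ) ≠ 0 := ofReal_ne_zero.mpr hw.ne'
    have hpow : (1 / (w : ℂ)) ^ s = (w : ℂ) ^ ((1 - s) - 1) := by
      rw [one_div, inv_cpow _ _ (by rw [arg_ofReal_of_nonneg hw.le]; exact Real.pi_pos.ne),
        ← cpow_neg]
      congr 1; ring
    rw [hpow] at hG
    rw [← mul_assoc, mul_comm (Gamma s), ← hG, ← integral_mul_const]
    congr 1; ext x
    push_cast
    rw [mul_assoc, ← exp_add]
    congr 2; ring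
  rw [hleft, hswap, hright, integral_const_mul,
    integral_cpow_mul_exp_neg_mul_Ioi (by simpa using h1) one_pos, ← Gamma_mul_Gamma_one_sub]
  simp

/-- The map `x ↦ log (1 + x)` has a convergent Mellin transform on the strip `-1 < Re s < 0`. -/
theorem mellinConvergent_log_one_add {s : ℂ} (h0 : -1 < s.re) (h1 : s.re < 0) :
    MellinConvergent (fun x : ℝ => (Real.log (1 + x) : ℂ)) s := by
  have hbound : ∀ x ε : ℝ, 0 < x → 0 < ε → ε ≤ 1 →
      ‖(Real.log (1 + x) : ℂ)‖ ≤ ε⁻¹ * ‖x ^ (- -ε)‖ := fun x ε hx hε hε1 => by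
    rw [neg_neg, norm_real, Real.norm_of_nonneg (Real.log_nonneg (by linarith)),
      Real.norm_of_nonneg (by positivity), ← div_eq_inv_mul]
    exact log_one_add_le_rpow_div hx hε hε1
  refine mellinConvergent_of_isBigO_rpow (a := -(-s.re / 2)) (b := -1) ?_ ?_ (by linarith) ?_ h0
  · refine ContinuousOn.locallyIntegrableOn ?_ measurableSet_Ioi
    refine continuous_ofReal.comp_continuousOn (ContinuousOn.log (by fun_prop) ?_)
    intro x (hx : 0 < x)
    positivity
  · refine Asymptotics.IsBigO.of_bound (-s.re / 2)⁻¹ ?_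
    filter_upwards [eventually_gt_atTop 0] with x hx
    exact hbound x _ hx (by linarith) (by linarith)
  · refine Asymptotics.IsBigO.of_bound 1⁻¹ ?_
    filter_upwards [self_mem_nhdsWithin] with x (hx : 0 < x)
    exact hbound x 1 hx one_pos le_rfl

/-- The Mellin transform of `log (1 + x)` is `π / (s sin (π s))` on the strip `-1 < Re s < 0`. -/
theorem mellin_log_one_add {s : ℂ} (h0 : -1 < s.re) (h1 : s.re < 0) :
    mellin (fun x : ℝ => (Real.log (1 + x) : ℂ)) s = π / (s * sin (π * s)) := by
  have hs : s ≠ 0 := fun h => by simp [h] at h1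
  have hbound : ∀ x ε : ℝ, 0 < x → 0 < ε → ε ≤ 1 →
      ‖(x : ℂ) ^ s / s * (Real.log (1 + x) : ℂ)‖ ≤ (‖s‖ * ε)⁻¹ * x ^ (s.re + ε) :=
    fun x ε hx hε hε1 => by
      rw [norm_mul, norm_div, norm_cpow_eq_rpow_re_of_pos hx, norm_real,
        Real.norm_of_nonneg (Real.log_nonneg (by linarith)), Real.rpow_add hx]
      calc x ^ s.re / ‖s‖ * Real.log (1 + x) ≤ x ^ s.re / ‖s‖ * (x ^ ε / ε) := by
            gcongr
            exact log_one_add_le_rpow_div hx hε hε1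
        _ = _ := by
            have := norm_pos_iff.mpr hs
            field_simp
  have hinv := mellinConvergent_inv_one_add (s := s + 1) (by simpa using by linarith)
    (by simpa using h1)
  have hsmul : ∀ x : ℝ, (x : ℂ) ^ s / s * (1 + (x : ℂ))⁻¹ =
      s⁻¹ * ((x : ℂ) ^ (s + 1 - 1) • (1 + (x : ℂ))⁻¹) := fun x => by
    rw [add_sub_cancel_right, smul_eq_mul]; ring
  have key := integral_Ioi_mul_deriv_eq_deriv_mul (a := (0 : ℝ)) (a' := (0 : ℂ)) (b' := (0 : ℂ))
    (u := fun x : ℝ => (x : ℂ) ^ s / s) (v := fun x : ℝ => (Real.log (1 + x) : ℂ))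
    (u' := fun x : ℝ => (x : ℂ) ^ (s - 1)) (v' := fun x : ℝ => (1 + (x : ℂ))⁻¹)
    ?_ ?_ ?_ (mellinConvergent_log_one_add h0 h1) ?_ ?_
  · have hm : ∫ x in Ioi (0 : ℝ), (x : ℂ) ^ s / s * (1 + (x : ℂ))⁻¹ =
        s⁻¹ * mellin (fun x : ℝ => (1 + (x : ℂ))⁻¹) (s + 1) := by
      simp_rw [hsmul]
      rw [integral_const_mul]; rfl
    rw [hm, mellin_inv_one_add (by simpa using by linarith) (by simpa using h1), mul_add,
      mul_one, sin_add_pi, sub_self, zero_sub, eq_neg_iff_add_eq_zero, add_comm,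
      ← eq_neg_iff_add_eq_zero] at key
    rw [mellin]
    simp only [smul_eq_mul]
    rw [key]
    field_simp
  · intro x (hx : 0 < x)
    have h := hasDerivAt_ofReal_cpow_const' (r := s - 1) hx.ne' (by simpa using hs)
    simpa using h
  · intro x (hx : 0 < x)
    have := ((hasDerivAt_id x).const_add 1).log (by simp; positivity)
    simpa using this.ofReal_comp
  · exact (hinv.const_mul s⁻¹).congr (ae_of_all _ fun x => (hsmul x).symm)
  · refine squeeze_zero_norm' (a := fun x : ℝ => (‖s‖ * 1)⁻¹ * x ^ (s.re + 1)) ?_ ?_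
    · filter_upwards [self_mem_nhdsWithin] with x (hx : 0 < x)
      exact hbound x 1 hx one_pos le_rfl
    · have : Tendsto (fun x : ℝ => x ^ (s.re + 1)) (𝓝[>] 0) (𝓝 0) := by
        have := (Real.continuousAt_rpow_const 0 (s.re + 1) (Or.inr (by linarith))).tendsto
        rw [Real.zero_rpow (by linarith)] at this
        exact this.mono_left nhdsWithin_le_nhds
      simpa using this.const_mul (‖s‖ * 1)⁻¹
  · refine squeeze_zero_norm' (a := fun x : ℝ => (‖s‖ * (-s.re / 2))⁻¹ * x ^ (s.re + -s.re / 2))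
      ?_ ?_
    · filter_upwards [eventually_gt_atTop 0] with x hx
      exact hbound x _ hx (by linarith) (by linarith)
    · have := tendsto_rpow_neg_atTop (y := -s.re / 2) (by linarith)
      have h := this.const_mul (‖s‖ * (-s.re / 2))⁻¹
      rw [mul_zero] at h
      convert h using 4
      ring

/-- The squared modulus of the sine at `x + i y` is `sin² x + sinh² y`. -/
theorem normSq_sin_add_mul_I (x y : ℝ) :
    normSq (sin (x + y * I)) = Real.sin x ^ 2 + Real.sinh y ^ 2 := by
  rw [sin_add_mul_I, ← ofReal_sin, ← ofReal_cos, ← ofReal_cosh, ← ofReal_sinh,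
    ← ofReal_mul, ← ofReal_mul, normSq_add_mul_I, mul_pow, mul_pow, Real.cosh_sq, Real.cos_sq']
  ring

/-- The kernel `π / (s sin (π s))` is integrable on vertical lines in the strip `-1 < Re s < 0`. -/
theorem integrable_pi_div_mul_sin {c : ℝ} (hc1 : -1 < c) (hc0 : c < 0) :
    Integrable (fun t : ℝ => (π : ℂ) / ((c + t * I) * sin (π * (c + t * I)))) := by
  set m : ℝ := min (|c| * |Real.sin (π * c)|) π
  have hsin : Real.sin (π * c) < 0 :=
    Real.sin_neg_of_neg_of_neg_pi_lt (by nlinarith [Real.pi_pos]) (by nlinarith [Real.pi_pos])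
  have hmpos : 0 < m := lt_min (mul_pos (abs_pos.mpr hc0.ne) (abs_pos.mpr hsin.ne)) Real.pi_pos
  refine (integrable_inv_one_add_sq.const_mul (2 * π / m)).mono'
    (Measurable.aestronglyMeasurable (by fun_prop)) (ae_of_all _ fun t => ?_)
  have hs1 : |c| ≤ ‖(c + t * I : ℂ)‖ := by simpa using abs_re_le_norm (c + t * I : ℂ)
  have hs2 : |t| ≤ ‖(c + t * I : ℂ)‖ := by simpa using abs_im_le_norm (c + t * I : ℂ)
  have hnsq : ‖sin (π * (c + t * I))‖ ^ 2 = Real.sin (π * c) ^ 2 + Real.sinh (π * t) ^ 2 := by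
    rw [← normSq_eq_norm_sq, ← normSq_sin_add_mul_I]
    congr 2; push_cast; ring
  have hsin1 : |Real.sin (π * c)| ≤ ‖sin (π * (c + t * I))‖ :=
    abs_le_of_sq_le_sq' (by rw [hnsq]; nlinarith [sq_nonneg (Real.sinh (π * t))]) (norm_nonneg _)
      |> abs_le.mpr
  have hsin2 : π * |t| ≤ ‖sin (π * (c + t * I))‖ := by
    have h1 : π * |t| ≤ |Real.sinh (π * t)| := by
      rw [Real.abs_sinh, abs_mul, abs_of_pos Real.pi_pos]
      exact Real.self_le_sinh_iff.mpr (by positivity)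
    refine h1.trans (abs_le.mpr (abs_le_of_sq_le_sq' ?_ (norm_nonneg _)))
    rw [hnsq]; nlinarith [sq_nonneg (Real.sin (π * c))]
  have hA := mul_le_mul hs1 hsin1 (abs_nonneg _) (norm_nonneg _)
  have hB := mul_le_mul hs2 hsin2 (by positivity) (norm_nonneg _)
  have hlow : m / 2 * (1 + t ^ 2) ≤ ‖(c + t * I : ℂ)‖ * ‖sin (π * (c + t * I))‖ := by
    have h1 : m ≤ |c| * |Real.sin (π * c)| := min_le_left _ _
    have h2 : m ≤ π := min_le_right _ _
    have h3 : |t| * (π * |t|) = π * t ^ 2 := by rw [← sq_abs t]; ring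
    nlinarith [sq_nonneg t, mul_le_mul_of_nonneg_right h2 (sq_nonneg t)]
  rw [norm_div, norm_mul, norm_real, Real.norm_of_nonneg Real.pi_pos.le]
  calc π / (‖(c + t * I : ℂ)‖ * ‖sin (π * (c + t * I))‖) ≤ π / (m / 2 * (1 + t ^ 2)) := by
        gcongr
    _ = 2 * π / m * (1 + t ^ 2)⁻¹ := by
        field_simp

/-- The Mellin inversion formula for `log (1 + x)`. -/
theorem log_one_add_eq_mellinInv {c x : ℝ} (hc1 : -1 < c) (hc0 : c < 0) (hx : 0 < x) :
    (Real.log (1 + x) : ℂ) = 1 / (2 * π) *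
      ∫ t : ℝ, (x : ℂ) ^ (-(c + t * I : ℂ)) * (π / ((c + t * I) * sin (π * (c + t * I)))) := by
  have hmel : ∀ t : ℝ, mellin (fun x : ℝ => (Real.log (1 + x) : ℂ)) (c + t * I) =
      π / ((c + t * I) * sin (π * (c + t * I))) := fun t =>
    mellin_log_one_add (by simpa using hc1) (by simpa using hc0)
  have h := mellinInv_mellin_eq c (fun x : ℝ => (Real.log (1 + x) : ℂ)) hx
    (mellinConvergent_log_one_add (by simpa using hc1) (by simpa using hc0))
    (by simpa only [VerticalIntegrable, hmel] using integrable_pi_div_mul_sin hc1 hc0)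
    (by
      refine continuous_ofReal.continuousAt.comp (ContinuousAt.log (by fun_prop) ?_)
      positivity)
  rw [← h, mellinInv]
  simp only [hmel, smul_eq_mul, real_smul]
  push_cast
  rfl

/-- Mellin–Parseval identity for `log (1 + x)` against a function whose weighted norm
`x ^ (-c) * ‖f x‖` is integrable. -/
theorem integral_log_one_add_mul_eq {f : ℝ → ℂ} {c : ℝ} (hc1 : -1 < c) (hc0 : c < 0)
    (hf : IntegrableOn (fun x : ℝ => (x : ℂ) ^ (-(c : ℂ)) * f x) (Ioi 0)) :
    ∫ x in Ioi (0 : ℝ), (Real.log (1 + x) : ℂ) * f x =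
      1 / (2 * π) * ∫ t : ℝ, (π / ((c + t * I) * sin (π * (c + t * I)))) *
        ∫ x in Ioi (0 : ℝ), (x : ℂ) ^ (-(c + t * I : ℂ)) * f x := by
  have hint : Integrable (fun p : ℝ × ℝ =>
      (π / ((c + p.1 * I) * sin (π * (c + p.1 * I)))) *
        ((p.2 : ℂ) ^ (-(c + p.1 * I : ℂ)) * f p.2))
      (volume.prod (volume.restrict (Ioi 0))) := by
    have hprod := (integrable_pi_div_mul_sin hc1 hc0).mul_prod hf
    have hbdd := hprod.bdd_mul (c := 1) (f := fun p : ℝ × ℝ => exp (-(p.1 * Real.log p.2 : ℝ) * I))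
      (Measurable.aestronglyMeasurable (by fun_prop)) (ae_of_all _ fun p => by
        rw [← ofReal_neg, norm_exp_ofReal_mul_I])
    refine hbdd.congr ?_
    have hpos : ∀ᵐ p : ℝ × ℝ ∂(volume.prod (volume.restrict (Ioi 0))), 0 < p.2 :=
      Measure.quasiMeasurePreserving_snd.ae (ae_restrict_mem measurableSet_Ioi)
    filter_upwards [hpos] with p hp
    have hp0 : (p.2 : ℂ) ≠ 0 := ofReal_ne_zero.mpr hp.ne'
    have : (p.2 : ℂ) ^ (-(c + p.1 * I : ℂ)) =
        exp (-(p.1 * Real.log p.2 : ℝ) * I) * (p.2 : ℂ) ^ (-(c : ℂ)) := by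
      rw [neg_add, cpow_add _ _ hp0, mul_comm, cpow_def_of_ne_zero hp0 (-(p.1 * I : ℂ)),
        ofReal_mul, ofReal_log hp.le]
      congr 2; ring
    rw [this]; ring
  have hswap := integral_integral_swap (f := fun t x : ℝ =>
    ((π : ℂ) / ((c + t * I) * sin (π * (c + t * I)))) * ((x : ℂ) ^ (-(c + t * I : ℂ)) * f x)) hint
  simp only [integral_const_mul] at hswap
  rw [hswap, ← integral_const_mul]
  refine setIntegral_congr_fun measurableSet_Ioi fun x (hx : 0 < x) => ?_
  rw [log_one_add_eq_mellinInv hc1 hc0 hx, mul_assoc, ← integral_mul_const]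
  congr 2; ext t; ring

/-- **Wiretap-channel capacity term of the average secrecy capacity (Theorem 4, eq. (22)).**
For a Fox H-function density `f_E` with data `(κ_E, λ_E, Θ_E, c_E)`, `c ∈ (−1,0)`,
with the Mellin transform of `f_E` equal to `κ_E λ_E^{−s} Θ_E(s)` on `Re s = 1−c`,
`E[ln(1+γ_E)] < ∞`, `t ↦ Θ_E(1−c−it) π/((c+it) sin(π(c+it)))` absolutely integrable,
and Mellin inversion for `f_E` holding on the line `Re s = 1−c`, one has
`∫₀^∞ ln(1+γ) f_E(γ) dγ = κ_E (1/(2π)) ∫_ℝ Θ_E(1−s) λ_E^{s−1} [π/(s sin(πs))] dt`,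
`s = c + it`. -/
theorem asc_I3_foxH (fE : ℝ → ℝ) (κE lamE cE c : ℝ) (DE : FoxData)
    (hfE : IsFoxDensity fE κE lamE DE cE)
    (hc1 : -1 < c) (hc0 : c < 0)
    (hMellinE : ∀ z : ℂ, z.re = 1 - c →
      IntegrableOn (fun x : ℝ => (x : ℂ) ^ (z - 1) * (fE x : ℂ)) (Ioi 0) ∧
        ∫ x in Ioi (0 : ℝ), (x : ℂ) ^ (z - 1) * (fE x : ℂ) =
          (κE : ℂ) * (lamE : ℂ) ^ (-z) * DE.kernel z)
    (hLogInt : IntegrableOn (fun γ : ℝ => Real.log (1 + γ) * fE γ) (Ioi 0))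
    (hKerInt : Integrable (fun t : ℝ =>
      DE.kernel (1 - ((c : ℂ) + (t : ℂ) * Complex.I)) *
        ((π : ℝ) / (((c : ℂ) + (t : ℂ) * Complex.I) *
          Complex.sin ((π : ℝ) * ((c : ℂ) + (t : ℂ) * Complex.I))))))
    (hInv : ∀ x : ℝ, 0 < x →
      (fE x : ℂ) = 1 / (2 * (π : ℝ)) *
        ∫ t : ℝ, ((κE : ℂ) * (lamE : ℂ) ^ (-(((1 - c : ℝ) : ℂ) + (t : ℂ) * Complex.I)) *
            DE.kernel (((1 - c : ℝ) : ℂ) + (t : ℂ) * Complex.I)) *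
          (x : ℂ) ^ (-(((1 - c : ℝ) : ℂ) + (t : ℂ) * Complex.I))) :
    ((∫ γ in Ioi (0 : ℝ), Real.log (1 + γ) * fE γ : ℝ) : ℂ) =
      (κE : ℂ) * (1 / (2 * (π : ℝ))) *
        ∫ t : ℝ,
          DE.kernel (1 - ((c : ℂ) + (t : ℂ) * Complex.I)) *
            (lamE : ℂ) ^ (((c : ℂ) + (t : ℂ) * Complex.I) - 1) *
            ((π : ℝ) / (((c : ℂ) + (t : ℂ) * Complex.I) *
              Complex.sin ((π : ℝ) * ((c : ℂ) + (t : ℂ) * Complex.I)))) := by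
  have hf : IntegrableOn (fun x : ℝ => (x : ℂ) ^ (-(c : ℂ)) * (fE x : ℂ)) (Ioi 0) := by
    have := (hMellinE (1 - c) (by simp)).1
    rwa [show (1 - c - 1 : ℂ) = -c by ring] at this
  have hmain := integral_log_one_add_mul_eq hc1 hc0 hf
  simp_rw [← ofReal_mul] at hmain
  rw [integral_complex_ofReal] at hmain
  rw [hmain, mul_comm (κE : ℂ), mul_assoc, ← integral_const_mul (κE : ℂ)]
  congr 2
  ext t
  have hM := (hMellinE (1 - (c + t * I)) (by simp)).2
  rw [show (1 - (c + t * I) - 1 : ℂ) = -(c + t * I) by ring,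
    show (-(1 - (c + t * I)) : ℂ) = c + t * I - 1 by ring] at hM
  rw [hM]
  ring
end
end
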